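/- arXiv:1012.4998 — 3 statements merged into one kernel-verified Lean document; each statement's English description precedes it below -/
import Mathlib

section
/- On the space of Cl(0,m)-valued polynomials, the anticommutators {(x•), ∂^+} = -A and {(x∧), ∂^-} = -B hold, where A = E + ∂^+⌋ and B = E + ∂^-⌋, E is the Euler operator, and ∂^+⌋, ∂^-⌋ are the fermionic Euler operators; moreover {(x•), ∂^-} = 0 and {(x∧), ∂^+} = 0. -/
noncomputable section
open scoped TensorProduct
open CliffordAlgebra MvPolynomial

/-- The quadratic form of signature (0,m): Q(x) = -|x|². -/
def Qf (m : ℕ) : QuadraticForm ℝ (Fin m → ℝ) :=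
  - QuadraticMap.weightedSumSquares ℝ (fun _ : Fin m => (1 : ℝ))

/-- The real Clifford algebra Cl(0,m). -/
abbrev Cl (m : ℕ) := CliffordAlgebra (Qf m)

/-- The generators e₁,…,e_m. -/
def e (m : ℕ) (i : Fin m) : Cl m := CliffordAlgebra.ι (Qf m) (Pi.single i 1)

/-- Left outer (wedge) multiplication by `c`:  v ↦ (1/2)(c v + α(v) c). -/
def wedgeL (m : ℕ) (c : Cl m) : Cl m →ₗ[ℝ] Cl m :=
  (1/2 : ℝ) • (LinearMap.mulLeft ℝ c +
    (LinearMap.mulRight ℝ c) ∘ₗ (involute (Q := Qf m)).toLinearMap)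

/-- Left inner (dot) multiplication by `c`:  v ↦ (1/2)(c v - α(v) c). -/
def dotL (m : ℕ) (c : Cl m) : Cl m →ₗ[ℝ] Cl m :=
  (1/2 : ℝ) • (LinearMap.mulLeft ℝ c -
    (LinearMap.mulRight ℝ c) ∘ₗ (involute (Q := Qf m)).toLinearMap)

/-- Scalar polynomials on ℝ^m. -/
abbrev Pm (m : ℕ) := MvPolynomial (Fin m) ℝ

/-- The space P* of Cl(0,m)-valued polynomials on ℝ^m. -/
abbrev MS (m : ℕ) := Pm m ⊗[ℝ] Cl m

/-- Build an operator on Cl-valued polynomials from operators on each factor. -/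
def op (m : ℕ) (f : Pm m →ₗ[ℝ] Pm m) (g : Cl m →ₗ[ℝ] Cl m) : Module.End ℝ (MS m) :=
  TensorProduct.map f g

/-- The operator (x∧) of outer multiplication by the vector variable. -/
def xWedge (m : ℕ) : Module.End ℝ (MS m) :=
  ∑ j : Fin m, op m (LinearMap.mulLeft ℝ (X j)) (wedgeL m (e m j))

/-- The operator (x•) of inner multiplication by the vector variable. -/
def xDot (m : ℕ) : Module.End ℝ (MS m) :=
  ∑ j : Fin m, op m (LinearMap.mulLeft ℝ (X j)) (dotL m (e m j))

/-- Left Clifford multiplication by the vector variable x. -/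
def Xmul (m : ℕ) : Module.End ℝ (MS m) :=
  ∑ j : Fin m, op m (LinearMap.mulLeft ℝ (X j)) (LinearMap.mulLeft ℝ (e m j))

/-- The Dirac operator ∂ = Σ e_j ∂_{x_j}. -/
def Dirac (m : ℕ) : Module.End ℝ (MS m) :=
  ∑ j : Fin m, op m (pderiv j).toLinearMap (LinearMap.mulLeft ℝ (e m j))

/-- The exterior part ∂⁺ of the Dirac operator. -/
def dplus (m : ℕ) : Module.End ℝ (MS m) :=
  ∑ j : Fin m, op m (pderiv j).toLinearMap (wedgeL m (e m j))

/-- The interior part ∂⁻ of the Dirac operator. -/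
def dminus (m : ℕ) : Module.End ℝ (MS m) :=
  ∑ j : Fin m, op m (pderiv j).toLinearMap (dotL m (e m j))

/-- The Euler operator E = Σ x_j ∂_{x_j}. -/
def Euler (m : ℕ) : Module.End ℝ (MS m) :=
  ∑ j : Fin m, op m (LinearMap.mulLeft ℝ (X j) ∘ₗ (pderiv j).toLinearMap) LinearMap.id

/-- The fermionic Euler operator ∂⁺⌋ = -Σ (e_j∧)(e_j•). -/
def fermPlus (m : ℕ) : Module.End ℝ (MS m) :=
  - ∑ j : Fin m, op m LinearMap.id (wedgeL m (e m j) ∘ₗ dotL m (e m j))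

/-- The fermionic Euler operator ∂⁻⌋ = -Σ (e_j•)(e_j∧). -/
def fermMinus (m : ℕ) : Module.End ℝ (MS m) :=
  - ∑ j : Fin m, op m LinearMap.id (dotL m (e m j) ∘ₗ wedgeL m (e m j))

/-- The Laplacian Δ = Σ ∂_{x_j}². -/
def Lap (m : ℕ) : Module.End ℝ (MS m) :=
  ∑ j : Fin m, op m ((pderiv j).toLinearMap ∘ₗ (pderiv j).toLinearMap) LinearMap.id

/-- Multiplication by the Clifford square x² = -(x₁²+⋯+x_m²) of the vector variable. -/
def Mx2 (m : ℕ) : Module.End ℝ (MS m) :=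
  op m (LinearMap.mulLeft ℝ (-(∑ j : Fin m, (X j : Pm m) ^ 2))) LinearMap.id

/-- The space Cl^s of s-vectors: the span of products of s distinct generators. -/
def clGrade (m s : ℕ) : Submodule ℝ (Cl m) :=
  Submodule.span ℝ
    {x | ∃ l : List (Fin m), l.length = s ∧ l.Nodup ∧ x = (l.map (e m)).prod}

/-- The space P_k^s of k-homogeneous s-vector valued polynomials. -/
def Pks (m k s : ℕ) : Submodule ℝ (MS m) :=
  LinearMap.range (TensorProduct.map
    (MvPolynomial.homogeneousSubmodule (Fin m) ℝ k).subtype (clGrade m s).subtype)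

/-- The space of s-vector valued polynomials (no homogeneity). -/
def PsVal (m s : ℕ) : Submodule ℝ (MS m) :=
  LinearMap.range (TensorProduct.map (LinearMap.id : Pm m →ₗ[ℝ] Pm m) (clGrade m s).subtype)

/-- Homogeneous solutions of the Hodge–de Rham system: ∂⁺P = 0 and ∂⁻P = 0. -/
def Hks (m k s : ℕ) : Submodule ℝ (MS m) :=
  Pks m k s ⊓ LinearMap.ker (dplus m) ⊓ LinearMap.ker (dminus m)

/-- Homogeneous s-vector valued monogenic polynomials: ∂P = 0. -/
def HksD (m k s : ℕ) : Submodule ℝ (MS m) :=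
  Pks m k s ⊓ LinearMap.ker (Dirac m)

/-- Ker_k^s ∂⁺. -/
def KerP (m k s : ℕ) : Submodule ℝ (MS m) :=
  Pks m k s ⊓ LinearMap.ker (dplus m)

/-- Ker_k^s ∂⁻. -/
def KerM (m k s : ℕ) : Submodule ℝ (MS m) :=
  Pks m k s ⊓ LinearMap.ker (dminus m)

end
section
open scoped TensorProduct
open CliffordAlgebra MvPolynomial

theorem e_anticomm (m : ℕ) (j k : Fin m) :
    e m j * e m k + e m k * e m j = algebraMap ℝ (Cl m) (if j = k then -2 else 0) := by
  unfold e
  rw [CliffordAlgebra.ι_mul_ι_add_swap]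
  congr 1
  simp only [QuadraticMap.polar, Qf, _root_.neg_apply,
    QuadraticMap.weightedSumSquares_apply, Pi.add_apply, one_smul]
  have h : ∀ i : Fin m, ((Pi.single j 1 : Fin m → ℝ) i + (Pi.single k 1 : Fin m → ℝ) i) *
      ((Pi.single j 1 : Fin m → ℝ) i + (Pi.single k 1 : Fin m → ℝ) i)
      = (Pi.single j 1 : Fin m → ℝ) i * (Pi.single j 1 : Fin m → ℝ) i
      + (Pi.single k 1 : Fin m → ℝ) i * (Pi.single k 1 : Fin m → ℝ) i
      + 2 * ((Pi.single j 1 : Fin m → ℝ) i * (Pi.single k 1 : Fin m → ℝ) i) := by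
    intro i; ring
  have h2 : ∑ i, (Pi.single j 1 : Fin m → ℝ) i * (Pi.single k 1 : Fin m → ℝ) i
      = if j = k then 1 else 0 := by
    simp [Pi.single_apply, eq_comm]
  rw [Finset.sum_congr rfl (fun i _ => h i), Finset.sum_add_distrib, Finset.sum_add_distrib,
    ← Finset.mul_sum, h2]
  split_ifs <;> ring

theorem inv_e (m : ℕ) (j : Fin m) : involute (e m j) = - e m j := by
  unfold e; exact CliffordAlgebra.involute_ι _

theorem wedge_apply (m : ℕ) (c v : Cl m) :
    wedgeL m c v = (1/2 : ℝ) • (c * v + involute v * c) := by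
  simp [wedgeL]

theorem dot_apply (m : ℕ) (c v : Cl m) :
    dotL m c v = (1/2 : ℝ) • (c * v - involute v * c) := by
  simp [dotL]

theorem dot_wedge (m : ℕ) (j k : Fin m) :
    dotL m (e m j) ∘ₗ wedgeL m (e m k) + wedgeL m (e m k) ∘ₗ dotL m (e m j)
      = (if j = k then (-1 : ℝ) else 0) • LinearMap.id := by
  apply LinearMap.ext
  intro v
  have h := e_anticomm m j k
  simp only [LinearMap.add_apply, LinearMap.comp_apply, dot_apply, wedge_apply, map_smul,
    map_add, map_sub, map_mul, inv_e, involute_involute, LinearMap.smul_apply, LinearMap.id_apply]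
  have key : (e m j * e m k + e m k * e m j) * v + v * (e m j * e m k + e m k * e m j)
      = (if j = k then (-4 : ℝ) else 0) • v := by
    rw [h, ← Algebra.commutes, ← Algebra.smul_def, ← add_smul]
    congr 1
    split_ifs <;> norm_num
  have h3 : (if j = k then (-1 : ℝ) else 0) • v
      = (1/4 : ℝ) • ((if j = k then (-4 : ℝ) else 0) • v) := by
    rw [smul_smul]; congr 1; split_ifs <;> norm_num
  rw [h3, ← key]
  simp only [mul_add, add_mul, mul_sub, sub_mul, smul_add, smul_sub, mul_smul_comm, smul_mul_assoc,
    neg_mul, mul_neg, smul_neg, smul_smul, mul_assoc]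
  module

theorem dot_dot (m : ℕ) (j k : Fin m) :
    dotL m (e m j) ∘ₗ dotL m (e m k) + dotL m (e m k) ∘ₗ dotL m (e m j)
      = (0 : ℝ) • LinearMap.id := by
  apply LinearMap.ext
  intro v
  have h := e_anticomm m j k
  simp only [LinearMap.add_apply, LinearMap.comp_apply, dot_apply, map_smul,
    map_add, map_sub, map_mul, inv_e, involute_involute, LinearMap.smul_apply, LinearMap.id_apply]
  have key : (e m j * e m k + e m k * e m j) * v - v * (e m j * e m k + e m k * e m j) = 0 := by
    rw [h, ← Algebra.commutes, sub_self]
  have h3 : (0 : ℝ) • v = (1/4 : ℝ) • (0 : Cl m) := by simp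
  rw [h3, ← key]
  simp only [mul_add, add_mul, mul_sub, sub_mul, smul_add, smul_sub, mul_smul_comm, smul_mul_assoc,
    neg_mul, mul_neg, smul_neg, smul_smul, mul_assoc]
  module

theorem wedge_wedge (m : ℕ) (j k : Fin m) :
    wedgeL m (e m j) ∘ₗ wedgeL m (e m k) + wedgeL m (e m k) ∘ₗ wedgeL m (e m j)
      = (0 : ℝ) • LinearMap.id := by
  apply LinearMap.ext
  intro v
  have h := e_anticomm m j k
  simp only [LinearMap.add_apply, LinearMap.comp_apply, wedge_apply, map_smul,
    map_add, map_sub, map_mul, inv_e, involute_involute, LinearMap.smul_apply, LinearMap.id_apply]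
  have key : (e m j * e m k + e m k * e m j) * v - v * (e m j * e m k + e m k * e m j) = 0 := by
    rw [h, ← Algebra.commutes, sub_self]
  have h3 : (0 : ℝ) • v = (1/4 : ℝ) • (0 : Cl m) := by simp
  rw [h3, ← key]
  simp only [mul_add, add_mul, mul_sub, sub_mul, smul_add, smul_sub, mul_smul_comm, smul_mul_assoc,
    neg_mul, mul_neg, smul_neg, smul_smul, mul_assoc]
  module

theorem pderiv_X_comm (m : ℕ) (j k : Fin m) :
    (pderiv k).toLinearMap ∘ₗ LinearMap.mulLeft ℝ (X j : Pm m)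
      = LinearMap.mulLeft ℝ (X j : Pm m) ∘ₗ (pderiv k).toLinearMap
        + (if j = k then (1 : ℝ) else 0) • LinearMap.id := by
  apply LinearMap.ext
  intro p
  by_cases h : j = k
  · subst h
    simp [Derivation.leibniz]
  · simp [Derivation.leibniz, pderiv_X_of_ne h, h]

theorem op_mul (m : ℕ) (f f' : Pm m →ₗ[ℝ] Pm m) (g g' : Cl m →ₗ[ℝ] Cl m) :
    op m f g * op m f' g' = op m (f ∘ₗ f') (g ∘ₗ g') := by
  unfold op
  exact (TensorProduct.map_comp _ _ _ _).symm

theorem neg_helper (m : ℕ) (A B : Module.End ℝ (MS m)) : (-1 : ℝ) • A + B = -(A + -B) := by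
  have hn : ∀ C : Module.End ℝ (MS m), -C = (-1 : ℝ) • C := by
    intro C
    apply LinearMap.ext
    intro p
    rw [LinearMap.smul_apply]
    have h1 : (-C) p + C p = 0 := by
      have h2 : (-C) p = -(C p) := rfl
      rw [h2]
      exact neg_add_cancel (C p)
    have h3 : (-1 : ℝ) • C p + C p = 0 := by
      have h4 : (-1 : ℝ) • C p + (1 : ℝ) • C p = 0 := by
        rw [← add_smul]; simp
      simpa using h4
    exact add_right_cancel (h1.trans h3.symm)
  rw [hn, hn, smul_add, smul_smul]
  norm_num

theorem general (m : ℕ) (a b : Fin m → (Cl m →ₗ[ℝ] Cl m)) (c : ℝ)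
    (h : ∀ j k, a j ∘ₗ b k + b k ∘ₗ a j = (if j = k then c else 0) • LinearMap.id) :
    (∑ j : Fin m, op m (LinearMap.mulLeft ℝ (X j)) (a j)) *
      (∑ j : Fin m, op m (pderiv j).toLinearMap (b j)) +
    (∑ j : Fin m, op m (pderiv j).toLinearMap (b j)) *
      (∑ j : Fin m, op m (LinearMap.mulLeft ℝ (X j)) (a j))
    = c • Euler m + ∑ j : Fin m, op m LinearMap.id (b j ∘ₗ a j) := by
  have hjk : ∀ j k : Fin m,
      op m (LinearMap.mulLeft ℝ (X j)) (a j) * op m (pderiv k).toLinearMap (b k) +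
      op m (pderiv k).toLinearMap (b k) * op m (LinearMap.mulLeft ℝ (X j)) (a j)
      = (if j = k then c • op m (LinearMap.mulLeft ℝ (X j) ∘ₗ (pderiv j).toLinearMap) LinearMap.id
          + op m LinearMap.id (b j ∘ₗ a j) else 0) := by
    intro j k
    rw [op_mul, op_mul, pderiv_X_comm]
    have h1 := h j k
    unfold op
    rw [TensorProduct.map_add_left, ← add_assoc, ← TensorProduct.map_add_right, h1,
      TensorProduct.map_smul_right, TensorProduct.map_smul_left]
    by_cases hh : j = k
    · subst hh; simp
    · simp [hh]
  rw [Finset.sum_mul_sum, Finset.sum_mul_sum, Finset.sum_comm (s := Finset.univ)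
    (f := fun i j => op m (pderiv i).toLinearMap (b i) * op m (LinearMap.mulLeft ℝ (X j)) (a j)),
    ← Finset.sum_add_distrib]
  simp_rw [← Finset.sum_add_distrib, hjk]
  simp [Euler, Finset.smul_sum, Finset.sum_add_distrib]

end

/-- {(x•),∂⁺} = -A, {(x∧),∂⁻} = -B, {(x•),∂⁻} = 0 = {(x∧),∂⁺},
where A = E + ∂⁺⌋ and B = E + ∂⁻⌋. -/
theorem stmt7 (m : ℕ) :
    xDot m * dplus m + dplus m * xDot m = -(Euler m + fermPlus m) ∧
    xWedge m * dminus m + dminus m * xWedge m = -(Euler m + fermMinus m) ∧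
    xDot m * dminus m + dminus m * xDot m = 0 ∧
    xWedge m * dplus m + dplus m * xWedge m = 0 := by
  refine ⟨?_, ?_, ?_, ?_⟩
  · have := general m (fun j => dotL m (e m j)) (fun j => wedgeL m (e m j)) (-1) (dot_wedge m)
    unfold xDot dplus fermPlus
    rw [this]
    exact neg_helper m _ _
  · have := general m (fun j => wedgeL m (e m j)) (fun j => dotL m (e m j)) (-1)
      (fun j k => by
        rw [add_comm, dot_wedge]; simp only [eq_comm])
    unfold xWedge dminus fermMinus
    rw [this]
    exact neg_helper m _ _
  · have := general m (fun j => dotL m (e m j)) (fun j => dotL m (e m j)) 0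
      (fun j k => by rw [dot_dot, ite_self])
    unfold xDot dminus
    rw [this]
    have h : ∀ j, dotL m (e m j) ∘ₗ dotL m (e m j) = 0 := fun j => by
      have := dot_dot m j j
      rw [zero_smul, ← two_smul ℝ] at this
      exact (smul_eq_zero.mp this).resolve_left two_ne_zero
    simp [h, op]
  · have := general m (fun j => wedgeL m (e m j)) (fun j => wedgeL m (e m j)) 0
      (fun j k => by rw [wedge_wedge, ite_self])
    unfold xWedge dplus
    rw [this]
    have h : ∀ j, wedgeL m (e m j) ∘ₗ wedgeL m (e m j) = 0 := fun j => by
      have := wedge_wedge m j j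
      rw [zero_smul, ← two_smul ℝ] at this
      exact (smul_eq_zero.mp this).resolve_left two_ne_zero
    simp [h, op]
end

section
/- The Cauchy-Kovalevskaya extension: if p_0 is a Cl(0,m)-valued k-homogeneous polynomial in the variables x_1,...,x_{m-1}, then p(x) = Σ_{j=0}^k (x_m^j/j!) (e_m ∂̲)^j p_0(x̲) is the unique k-homogeneous monogenic polynomial in ℝ^m (∂p = 0) with p(x̲, 0) = p_0(x̲), where ∂̲ = Σ_{j=1}^{m-1} e_j ∂_{x_j}. -/
noncomputable section
open scoped TensorProduct
open CliffordAlgebra MvPolynomial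
/-- The Dirac operator ∂̲ in the first m variables, inside dimension m+1. -/
def DiracU (m : ℕ) : Module.End ℝ (MS (m + 1)) :=
  ∑ j : Fin m, op (m + 1) (pderiv (Fin.castSucc j)).toLinearMap
    (LinearMap.mulLeft ℝ (e (m + 1) (Fin.castSucc j)))

/-- The operator e_m ∂̲. -/
def emDbar (m : ℕ) : Module.End ℝ (MS (m + 1)) :=
  op (m + 1) LinearMap.id (LinearMap.mulLeft ℝ (e (m + 1) (Fin.last m))) * DiracU m

/-- Multiplication by the last variable x_m. -/
def MxLast (m : ℕ) : Module.End ℝ (MS (m + 1)) :=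
  op (m + 1) (LinearMap.mulLeft ℝ (X (Fin.last m))) LinearMap.id

/-- Restriction to the hyperplane x_m = 0 (substitution x_m := 0). -/
def Ev0 (m : ℕ) : Module.End ℝ (MS (m + 1)) :=
  op (m + 1)
    ((MvPolynomial.aeval (fun i : Fin (m + 1) =>
        if i = Fin.last m then 0 else X i) : Pm (m + 1) →ₐ[ℝ] Pm (m + 1)).toLinearMap)
    LinearMap.id

/-- k-homogeneous Cl-valued polynomials. -/
def HomK (m k : ℕ) : Submodule ℝ (MS (m + 1)) :=
  LinearMap.range (TensorProduct.map
    (MvPolynomial.homogeneousSubmodule (Fin (m + 1)) ℝ k).subtype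
    (LinearMap.id : Cl (m + 1) →ₗ[ℝ] Cl (m + 1)))

/-- Cl-valued polynomials depending only on the first m variables. -/
def NoLast (m : ℕ) : Submodule ℝ (MS (m + 1)) :=
  LinearMap.range (TensorProduct.map
    (Subalgebra.toSubmodule
      (MvPolynomial.supported ℝ {i : Fin (m + 1) | i ≠ Fin.last m})).subtype
    (LinearMap.id : Cl (m + 1) →ₗ[ℝ] Cl (m + 1)))

/-- The Cauchy–Kovalevskaya extension Σ_{j=0}^k (x_m^j/j!) (e_m ∂̲)^j p₀. -/
def CKext (m k : ℕ) (p₀ : MS (m + 1)) : MS (m + 1) :=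
  ∑ j ∈ Finset.range (k + 1),
    ((j.factorial : ℝ)⁻¹) • ((MxLast m ^ j) ((emDbar m ^ j) p₀))

/-- The derivative in the last variable. -/
def DmL (m : ℕ) : Module.End ℝ (MS (m + 1)) :=
  op (m + 1) (pderiv (Fin.last m)).toLinearMap LinearMap.id

/-- Left multiplication by the last generator. -/
def EmL (m : ℕ) : Module.End ℝ (MS (m + 1)) :=
  op (m + 1) LinearMap.id (LinearMap.mulLeft ℝ (e (m + 1) (Fin.last m)))

/-- Formal integration in the last variable, scalar polynomials. -/
def intLast (m : ℕ) : Pm (m + 1) →ₗ[ℝ] Pm (m + 1) :=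
  (MvPolynomial.basisMonomials (Fin (m + 1)) ℝ).constr ℝ
    (fun s => monomial (s + Finsupp.single (Fin.last m) 1) (((s (Fin.last m) : ℝ) + 1)⁻¹))

theorem op_mul_op (n : ℕ) (f f' : Pm n →ₗ[ℝ] Pm n) (g g' : Cl n →ₗ[ℝ] Cl n) :
    op n f g * op n f' g' = op n (f ∘ₗ f') (g ∘ₗ g') :=
  (TensorProduct.map_comp f g f' g').symm

theorem op_apply_tmul (n : ℕ) (f : Pm n →ₗ[ℝ] Pm n) (g : Cl n →ₗ[ℝ] Cl n) (a : Pm n) (b : Cl n) :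
    op n f g (a ⊗ₜ b) = f a ⊗ₜ g b := TensorProduct.map_tmul f g a b

theorem e_sq (n : ℕ) (i : Fin n) : e n i * e n i = -1 := by
  rw [e, CliffordAlgebra.ι_sq_scalar]
  have : Qf n (Pi.single i 1) = -1 := by
    simp [Qf, QuadraticMap.weightedSumSquares_apply, Pi.single_apply]
  rw [this]; simp

theorem EmL_sq (m : ℕ) : EmL m * EmL m = -1 := by
  rw [EmL, op_mul_op]
  apply TensorProduct.ext'
  intro a b
  rw [op_apply_tmul]
  simp [← mul_assoc, e_sq, TensorProduct.tmul_neg]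

theorem Dirac_eq (m : ℕ) : Dirac (m + 1) = DiracU m + EmL m * DmL m := by
  rw [Dirac, Fin.sum_univ_castSucc, DiracU, EmL, DmL, op_mul_op]
  rfl

theorem emDbar_eq (m : ℕ) : emDbar m = EmL m * DiracU m := rfl

theorem EmL_EmL (m : ℕ) (x : MS (m + 1)) : EmL m (EmL m x) = -x := by
  rw [← Module.End.mul_apply, EmL_sq]; rfl

theorem Em_Dirac (m : ℕ) (q : MS (m + 1)) :
    EmL m (Dirac (m + 1) q) = emDbar m q - DmL m q := by
  rw [Dirac_eq, LinearMap.add_apply, map_add, Module.End.mul_apply, EmL_EmL, emDbar_eq,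
    Module.End.mul_apply, sub_eq_add_neg]

theorem Dirac_zero_iff (m : ℕ) (q : MS (m + 1)) :
    Dirac (m + 1) q = 0 ↔ DmL m q = emDbar m q := by
  have key := Em_Dirac m q
  constructor
  · intro h
    rw [h, map_zero] at key
    exact (sub_eq_zero.mp key.symm).symm
  · intro h
    rw [h, sub_self] at key
    have h2 := EmL_EmL m (Dirac (m + 1) q)
    rw [key, map_zero] at h2
    exact neg_eq_zero.mp h2.symm

/-- A scalar operator commuting with the first derivatives commutes with `emDbar`. -/
theorem commute_emDbar (m : ℕ) (f : Pm (m + 1) →ₗ[ℝ] Pm (m + 1))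
    (hf : ∀ (j : Fin m) p, f (pderiv (Fin.castSucc j) p) = pderiv (Fin.castSucc j) (f p)) :
    op (m + 1) f LinearMap.id * emDbar m = emDbar m * op (m + 1) f LinearMap.id := by
  rw [emDbar, DiracU, Finset.mul_sum, Finset.mul_sum, Finset.sum_mul]
  refine Finset.sum_congr rfl fun j _ => ?_
  rw [op_mul_op, op_mul_op, op_mul_op]
  congr 1
  refine LinearMap.ext fun p => ?_
  exact hf j p

theorem pderiv_comm_aux (m : ℕ) (i j : Fin m) (p : Pm m) :
    pderiv i (pderiv j p) = pderiv j (pderiv i p) := by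
  have h : ⁅(pderiv i : Derivation ℝ (Pm m) (Pm m)),
      (pderiv j : Derivation ℝ (Pm m) (Pm m))⁆ = 0 := by
    apply MvPolynomial.derivation_ext
    intro k
    simp [Derivation.commutator_apply, pderiv_X, Pi.single_apply]
    split_ifs <;> simp
  have := DFunLike.congr_fun h p
  rw [Derivation.commutator_apply] at this
  exact sub_eq_zero.mp this

theorem DmL_comm (m : ℕ) : DmL m * emDbar m = emDbar m * DmL m :=
  commute_emDbar m _ fun j p => pderiv_comm_aux _ _ _ p

theorem MxLast_comm (m : ℕ) : MxLast m * emDbar m = emDbar m * MxLast m :=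
  commute_emDbar m _ fun j p => by
    simp [Derivation.leibniz, pderiv_X_of_ne (Fin.castSucc_lt_last j).ne']

/-- substitution of zero for the last variable -/
def ev0 (m : ℕ) : Pm (m + 1) →ₐ[ℝ] Pm (m + 1) :=
  MvPolynomial.aeval (fun i : Fin (m + 1) => if i = Fin.last m then 0 else X i)

theorem Ev0_eq (m : ℕ) : Ev0 m = op (m + 1) (ev0 m).toLinearMap LinearMap.id := rfl

theorem ev0_pderiv (m : ℕ) (j : Fin m) (p : Pm (m + 1)) :
    ev0 m (pderiv (Fin.castSucc j) p) = pderiv (Fin.castSucc j) (ev0 m p) := by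
  induction p using MvPolynomial.induction_on with
  | C a => simp [ev0]
  | add p q hp hq => simp [hp, hq]
  | mul_X p i hp =>
    simp only [Derivation.leibniz, map_add, map_mul, smul_eq_mul, hp]
    have : ev0 m (pderiv (Fin.castSucc j) (X i)) = pderiv (Fin.castSucc j) (ev0 m (X i)) := by
      by_cases hi : i = Fin.last m
      · subst hi
        simp [ev0, pderiv_X_of_ne (Fin.castSucc_lt_last j).ne']
      · by_cases hij : i = Fin.castSucc j
        · subst hij; simp [ev0, (Fin.castSucc_lt_last j).ne]
        · simp [ev0, hi, pderiv_X_of_ne hij]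
    rw [this]

theorem Ev0_comm (m : ℕ) : Ev0 m * emDbar m = emDbar m * Ev0 m :=
  commute_emDbar m _ fun j p => ev0_pderiv m j p

theorem Ev0_MxLast (m : ℕ) : Ev0 m * MxLast m = 0 := by
  rw [Ev0_eq, MxLast, op_mul_op]
  apply TensorProduct.ext'
  intro a b
  rw [op_apply_tmul]
  simp [ev0]

theorem DmL_MxLast (m : ℕ) : DmL m * MxLast m = MxLast m * DmL m + 1 := by
  rw [DmL, MxLast, op_mul_op, op_mul_op]
  apply TensorProduct.ext'
  intro a b
  rw [LinearMap.add_apply, op_apply_tmul, op_apply_tmul]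
  simp [Derivation.leibniz, TensorProduct.add_tmul]

theorem DmL_MxLast_pow (m j : ℕ) :
    DmL m * MxLast m ^ (j + 1) = MxLast m ^ (j + 1) * DmL m + (j + 1 : ℝ) • MxLast m ^ j := by
  induction j with
  | zero => simp [DmL_MxLast]
  | succ j ih =>
    rw [pow_succ (MxLast m) (j + 1), ← mul_assoc, ih, add_mul, mul_assoc, DmL_MxLast, mul_add,
      mul_one, smul_mul_assoc, ← pow_succ]
    push_cast
    rw [← mul_assoc, add_smul (j + 1 : ℝ) 1, one_smul]
    abel

theorem NoLast_facts (m : ℕ) (p : MS (m + 1)) (h : p ∈ NoLast m) :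
    Ev0 m p = p ∧ DmL m p = 0 := by
  obtain ⟨t, rfl⟩ := h
  induction t using TensorProduct.induction_on with
  | zero => simp
  | add x y hx hy =>
    rw [map_add, map_add, map_add, hx.1, hx.2, hy.1, hy.2]; simp
  | tmul x y =>
    obtain ⟨x, hx⟩ := x
    have hx' : x ∈ MvPolynomial.supported ℝ {i : Fin (m + 1) | i ≠ Fin.last m} := hx
    rw [TensorProduct.map_tmul, Ev0_eq, DmL, op_apply_tmul, op_apply_tmul]
    have hv : Fin.last m ∉ x.vars := fun hmem => (MvPolynomial.mem_supported.mp hx' hmem) rfl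
    constructor
    · have : ev0 m x = x := by
        conv_rhs => rw [← MvPolynomial.aeval_X_left_apply x]
        apply MvPolynomial.eval₂Hom_congr' rfl _ rfl
        intro i hi _
        have : i ≠ Fin.last m := fun h => hv (h ▸ hi)
        simp [this]
      simp [this]
    · simp [MvPolynomial.pderiv_eq_zero_of_notMem_vars hv]

theorem HomK_map (m k l : ℕ) (f : Pm (m + 1) →ₗ[ℝ] Pm (m + 1)) (g : Cl (m + 1) →ₗ[ℝ] Cl (m + 1))
    (hf : ∀ p, p.IsHomogeneous k → (f p).IsHomogeneous l) (q : MS (m + 1)) (h : q ∈ HomK m k) :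
    op (m + 1) f g q ∈ HomK m l := by
  obtain ⟨t, rfl⟩ := h
  induction t using TensorProduct.induction_on with
  | zero => simp
  | add x y hx hy => rw [map_add, map_add]; exact add_mem hx hy
  | tmul x y =>
    rw [TensorProduct.map_tmul, op_apply_tmul]
    refine ⟨(⟨f x.1, hf _ x.2⟩ : MvPolynomial.homogeneousSubmodule (Fin (m + 1)) ℝ l) ⊗ₜ g y, ?_⟩
    rw [TensorProduct.map_tmul]; rfl

theorem HomK_zero_map (m : ℕ) (i : Fin (m + 1)) (g : Cl (m + 1) →ₗ[ℝ] Cl (m + 1))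
    (q : MS (m + 1)) (h : q ∈ HomK m 0) :
    op (m + 1) (pderiv i).toLinearMap g q = 0 := by
  obtain ⟨t, rfl⟩ := h
  induction t using TensorProduct.induction_on with
  | zero => simp
  | add x y hx hy => rw [map_add, map_add, hx, hy, add_zero]
  | tmul x y =>
    rw [TensorProduct.map_tmul, op_apply_tmul]
    have hx : (x.1).IsHomogeneous 0 := x.2
    have := MvPolynomial.totalDegree_eq_zero_iff_eq_C.mp
      (Nat.le_zero.mp hx.totalDegree_le)
    have h0 : (pderiv i) x.1 = 0 := by rw [this]; simp
    simp [h0]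

theorem emDbar_HomK (m k : ℕ) (q : MS (m + 1)) (h : q ∈ HomK m (k + 1)) :
    emDbar m q ∈ HomK m k := by
  rw [emDbar, Module.End.mul_apply]
  refine HomK_map m k k _ _ (fun p hp => hp) _ ?_
  rw [DiracU, LinearMap.sum_apply]
  exact Submodule.sum_mem _ fun j _ => HomK_map m (k + 1) k _ _ (fun p hp => hp.pderiv) _ h

theorem DmL_HomK (m k : ℕ) (q : MS (m + 1)) (h : q ∈ HomK m (k + 1)) :
    DmL m q ∈ HomK m k :=
  HomK_map m (k + 1) k _ _ (fun p hp => hp.pderiv) _ h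

theorem emDbar_HomK_zero (m : ℕ) (q : MS (m + 1)) (h : q ∈ HomK m 0) :
    emDbar m q = 0 := by
  rw [emDbar, Module.End.mul_apply, DiracU, LinearMap.sum_apply,
    Finset.sum_eq_zero fun j _ => HomK_zero_map m _ _ q h, map_zero]

theorem MxLast_HomK (m k : ℕ) (q : MS (m + 1)) (h : q ∈ HomK m k) :
    MxLast m q ∈ HomK m (k + 1) :=
  HomK_map m k (k + 1) _ _ (fun p hp => by
    have h3 := (MvPolynomial.isHomogeneous_X ℝ (Fin.last m)).mul hp
    rwa [add_comm 1 k] at h3) _ h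

theorem MxLast_pow_HomK (m k j : ℕ) (q : MS (m + 1)) (h : q ∈ HomK m k) :
    (MxLast m ^ j) q ∈ HomK m (k + j) := by
  induction j with
  | zero => simpa using h
  | succ j ih => rw [pow_succ', Module.End.mul_apply]; exact MxLast_HomK m _ _ ih

theorem emDbar_pow_HomK (m j k : ℕ) (q : MS (m + 1)) (h : q ∈ HomK m (k + j)) :
    (emDbar m ^ j) q ∈ HomK m k := by
  induction j generalizing k with
  | zero => simpa using h
  | succ j ih =>
    rw [pow_succ', Module.End.mul_apply]
    exact emDbar_HomK m _ _ (ih (k + 1) (by rwa [add_assoc, add_comm 1]))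

theorem emDbar_pow_eq_zero (m k : ℕ) (q : MS (m + 1)) (h : q ∈ HomK m k) :
    (emDbar m ^ (k + 1)) q = 0 := by
  rw [pow_succ', Module.End.mul_apply]
  exact emDbar_HomK_zero m _ (emDbar_pow_HomK m k 0 q (by simpa using h))

theorem intLast_monomial (m : ℕ) (s : Fin (m + 1) →₀ ℕ) :
    intLast m (monomial s 1) =
      monomial (s + Finsupp.single (Fin.last m) 1) (((s (Fin.last m) : ℝ) + 1)⁻¹) := by
  have := (MvPolynomial.basisMonomials (Fin (m + 1)) ℝ).constr_basis ℝ
    (fun s => (monomial (s + Finsupp.single (Fin.last m) 1) (((s (Fin.last m) : ℝ) + 1)⁻¹) :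
      Pm (m + 1))) s
  rwa [MvPolynomial.coe_basisMonomials] at this

theorem int_formula (m : ℕ) (s : Fin (m + 1) →₀ ℕ) :
    ev0 m (monomial s (1 : ℝ)) + intLast m (pderiv (Fin.last m) (monomial s 1)) = monomial s 1 := by
  rw [pderiv_monomial]
  by_cases hs : s (Fin.last m) = 0
  · simp only [hs, Nat.cast_zero, mul_zero, map_zero, add_zero]
    rw [ev0, MvPolynomial.aeval_monomial, MvPolynomial.monomial_eq]
    simp only [map_one, one_mul]
    refine Finset.prod_congr rfl fun i hi => ?_
    have : i ≠ Fin.last m := by rintro rfl; exact (Finsupp.mem_support_iff.mp hi) hs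
    simp [this]
  · have h1 : ev0 m (monomial s (1 : ℝ)) = 0 := by
      rw [ev0, MvPolynomial.aeval_monomial]
      simp only [map_one, one_mul]
      refine Finset.prod_eq_zero (Finsupp.mem_support_iff.mpr hs) ?_
      simp [hs]
    have hle : Finsupp.single (Fin.last m) 1 ≤ s := by
      rw [Finsupp.single_le_iff]; omega
    rw [h1, zero_add, one_mul, ← mul_one ((s (Fin.last m) : ℝ)), ← smul_eq_mul,
      ← MvPolynomial.smul_monomial, map_smul, intLast_monomial, MvPolynomial.smul_monomial,
      tsub_add_cancel_of_le hle]
    congr 1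
    have hs' : (s (Fin.last m) : ℝ) ≠ 0 := by exact_mod_cast hs
    rw [Finsupp.tsub_apply, Finsupp.single_eq_same, Nat.cast_sub (by omega)]
    simp [hs']

theorem Ev0_add_int (m : ℕ) :
    Ev0 m + op (m + 1) (intLast m) LinearMap.id * DmL m = 1 := by
  have key : (ev0 m).toLinearMap + intLast m ∘ₗ (pderiv (Fin.last m)).toLinearMap
      = LinearMap.id := by
    apply (MvPolynomial.basisMonomials (Fin (m + 1)) ℝ).ext
    intro s
    rw [MvPolynomial.coe_basisMonomials]
    exact int_formula m s
  rw [Ev0_eq, DmL, op_mul_op]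
  apply TensorProduct.ext'
  intro a b
  rw [LinearMap.add_apply, op_apply_tmul, op_apply_tmul]
  have := LinearMap.congr_fun key a
  simp only [LinearMap.comp_id, LinearMap.id_apply, ← TensorProduct.add_tmul]
  rw [← LinearMap.add_apply, this]
  rfl

theorem eq_zero_of (m : ℕ) (r : MS (m + 1)) (h0 : Ev0 m r = 0) (h1 : DmL m r = 0) : r = 0 := by
  have := LinearMap.congr_fun (Ev0_add_int m) r
  rw [LinearMap.add_apply, Module.End.mul_apply, h0, h1, map_zero, add_zero] at this
  exact this.symm

theorem unique_aux (m k : ℕ) (r : MS (m + 1)) (h : r ∈ HomK m k)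
    (hD : DmL m r = emDbar m r) (h0 : Ev0 m r = 0) : r = 0 := by
  induction k generalizing r with
  | zero => exact eq_zero_of m r h0 (HomK_zero_map m _ _ r h)
  | succ k ih =>
    refine eq_zero_of m r h0 (ih _ (DmL_HomK m k r h) ?_ ?_)
    · conv_lhs => rw [hD]
      exact LinearMap.congr_fun (DmL_comm m) r
    · rw [hD, ← Module.End.mul_apply, Ev0_comm, Module.End.mul_apply, h0, map_zero]

theorem CK_HomK (m k : ℕ) (p₀ : MS (m + 1)) (h1 : p₀ ∈ HomK m k) : CKext m k p₀ ∈ HomK m k := by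
  refine Submodule.sum_mem _ fun j hj => Submodule.smul_mem _ _ ?_
  have hj' : j ≤ k := by simpa [Nat.lt_succ_iff] using hj
  have := MxLast_pow_HomK m (k - j) j _ (emDbar_pow_HomK m j (k - j) p₀
    (by rwa [Nat.sub_add_cancel hj']))
  rwa [Nat.sub_add_cancel hj'] at this

theorem CK_Ev0 (m k : ℕ) (p₀ : MS (m + 1)) (h2 : p₀ ∈ NoLast m) : Ev0 m (CKext m k p₀) = p₀ := by
  rw [CKext, Finset.sum_range_succ', map_add, map_sum, Finset.sum_eq_zero]
  · simp [(NoLast_facts m p₀ h2).1]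
  · intro j _
    rw [map_smul, pow_succ', Module.End.mul_apply, ← Module.End.mul_apply, Ev0_MxLast]
    simp

theorem CK_Dm (m k : ℕ) (p₀ : MS (m + 1)) (h1 : p₀ ∈ HomK m k) (h2 : p₀ ∈ NoLast m) :
    DmL m (CKext m k p₀) = emDbar m (CKext m k p₀) := by
  have hT : ∀ j, DmL m ((emDbar m ^ j) p₀) = 0 := fun j => by
    have hc : Commute (DmL m) (emDbar m ^ j) := Commute.pow_right (DmL_comm m) j
    rw [← Module.End.mul_apply, hc.eq, Module.End.mul_apply, (NoLast_facts m p₀ h2).2, map_zero]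
  have hM : ∀ j x, emDbar m ((MxLast m ^ j) x) = (MxLast m ^ j) (emDbar m x) := fun j x => by
    have hc : Commute (MxLast m ^ j) (emDbar m) := Commute.pow_left (MxLast_comm m) j
    rw [← Module.End.mul_apply, ← hc.eq, Module.End.mul_apply]
  rw [CKext, map_sum, map_sum, Finset.sum_range_succ', Finset.sum_range_succ]
  congr 1
  · refine Finset.sum_congr rfl fun j _ => ?_
    rw [map_smul, map_smul, hM, ← Module.End.mul_apply (DmL m), DmL_MxLast_pow,
      LinearMap.add_apply, Module.End.mul_apply, hT, map_zero, zero_add, LinearMap.smul_apply,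
      smul_smul, ← Module.End.mul_apply (emDbar m), ← pow_succ']
    congr 1
    rw [Nat.factorial_succ]
    have h3 : (j.factorial : ℝ) ≠ 0 := by exact_mod_cast j.factorial_ne_zero
    have h4 : (j + 1 : ℝ) ≠ 0 := by positivity
    push_cast
    field_simp
  · rw [map_smul, map_smul, hM, ← Module.End.mul_apply (emDbar m), ← pow_succ',
      emDbar_pow_eq_zero m k p₀ h1]
    simpa using (NoLast_facts m p₀ h2).2

/-- the CK extension of a k-homogeneous polynomial p₀ in the first m
variables is the unique k-homogeneous monogenic polynomial restricting to p₀ on x_m = 0. -/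
theorem stmt16 (m k : ℕ) (p₀ : MS (m + 1)) (h1 : p₀ ∈ HomK m k) (h2 : p₀ ∈ NoLast m) :
    Dirac (m + 1) (CKext m k p₀) = 0 ∧
    CKext m k p₀ ∈ HomK m k ∧
    Ev0 m (CKext m k p₀) = p₀ ∧
    ∀ q : MS (m + 1), Dirac (m + 1) q = 0 → q ∈ HomK m k → Ev0 m q = p₀ →
      q = CKext m k p₀ := by
  have hD := CK_Dm m k p₀ h1 h2
  refine ⟨(Dirac_zero_iff m _).mpr hD, CK_HomK m k p₀ h1, CK_Ev0 m k p₀ h2, ?_⟩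
  intro q hq hk h0
  rw [← sub_eq_zero]
  refine unique_aux m k _ (sub_mem hk (CK_HomK m k p₀ h1)) ?_ ?_
  · rw [map_sub, map_sub, hD, (Dirac_zero_iff m q).mp hq]
  · rw [map_sub, h0, CK_Ev0 m k p₀ h2, sub_self]
end
end

section
/- On the space H_{k-2j-2}^s of homogeneous solutions of the Hodge-de Rham system, the operator Ẏ_{2j+2} = x^{2j+1}((x•)(A+2j+2) + (x∧)A) satisfies ∂^+ Ẏ_{2j+2} = 0 and ∂^- Ẏ_{2j+2} = -(2j+2)(m+2k-2j-2) x^{2j}(x•) on that space, where A = E + ∂^+⌋. -/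
noncomputable section
open scoped TensorProduct
open CliffordAlgebra MvPolynomial

namespace S18

lemma op_mul (m : ℕ) (f f' : Pm m →ₗ[ℝ] Pm m) (g g' : Cl m →ₗ[ℝ] Cl m) :
    op m f g * op m f' g' = op m (f ∘ₗ f') (g ∘ₗ g') := by
  unfold op
  rw [TensorProduct.map_comp]
  rfl

lemma e_anti (m : ℕ) (i j : Fin m) :
    e m i * e m j + e m j * e m i = algebraMap ℝ (Cl m) (if i = j then -2 else 0) := by
  unfold e
  rw [CliffordAlgebra.ι_mul_ι_add_swap]
  congr 1
  simp only [Qf, QuadraticMap.polar, neg_apply,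
    QuadraticMap.weightedSumSquares_apply, one_smul, Pi.add_apply]
  have : ∀ k : Fin m, ((Pi.single i 1 : Fin m → ℝ) k + (Pi.single j 1 : Fin m → ℝ) k) *
      ((Pi.single i 1 : Fin m → ℝ) k + (Pi.single j 1 : Fin m → ℝ) k) =
      (Pi.single i 1 : Fin m → ℝ) k * (Pi.single i 1 : Fin m → ℝ) k +
      (Pi.single j 1 : Fin m → ℝ) k * (Pi.single j 1 : Fin m → ℝ) k +
      2 * ((Pi.single i 1 : Fin m → ℝ) k * (Pi.single j 1 : Fin m → ℝ) k) := by
    intro k; ring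
  simp only [this, Finset.sum_add_distrib, ← Finset.mul_sum]
  have h2 : ∑ k : Fin m, (Pi.single i 1 : Fin m → ℝ) k * (Pi.single j 1 : Fin m → ℝ) k
      = if i = j then 1 else 0 := by
    simp [Pi.single_apply, eq_comm]
  rw [h2]
  split_ifs <;> ring

lemma inv_e (m : ℕ) (i : Fin m) : involute (e m i) = - e m i := by
  unfold e; exact involute_ι _

lemma wedge_apply (m : ℕ) (c v : Cl m) :
    wedgeL m c v = (1/2 : ℝ) • (c * v + involute v * c) := by
  simp [wedgeL]

lemma dot_apply (m : ℕ) (c v : Cl m) :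
    dotL m c v = (1/2 : ℝ) • (c * v - involute v * c) := by
  simp [dotL]

lemma aa (m : ℕ) (i j : Fin m) :
    wedgeL m (e m i) ∘ₗ wedgeL m (e m j) + wedgeL m (e m j) ∘ₗ wedgeL m (e m i) = 0 := by
  ext v
  have h := e_anti m i j
  set t : ℝ := if i = j then -2 else 0
  have hc := Algebra.commutes t v
  rw [← h] at hc
  simp only [LinearMap.add_apply, LinearMap.comp_apply, wedge_apply, map_smul, map_add, map_mul,
    inv_e, involute_involute, LinearMap.zero_apply, 
    ← smul_add, smul_smul]
  refine (congrArg ((1/2*(1/2) : ℝ) • ·) ?_).trans (smul_zero (1/2*(1/2) : ℝ))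
  rw [← sub_eq_zero] at hc
  rw [← hc]
  noncomm_ring

lemma bb (m : ℕ) (i j : Fin m) :
    dotL m (e m i) ∘ₗ dotL m (e m j) + dotL m (e m j) ∘ₗ dotL m (e m i) = 0 := by
  ext v
  have h := e_anti m i j
  set t : ℝ := if i = j then -2 else 0
  have hc := Algebra.commutes t v
  rw [← h] at hc
  simp only [LinearMap.add_apply, LinearMap.comp_apply, dot_apply, map_smul, map_sub, map_mul,
    inv_e, involute_involute, LinearMap.zero_apply, 
    ← smul_add, ← smul_sub, smul_smul]
  refine (congrArg ((1/2*(1/2) : ℝ) • ·) ?_).trans (smul_zero (1/2*(1/2) : ℝ))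
  rw [← sub_eq_zero] at hc
  rw [← hc]
  noncomm_ring

lemma ab (m : ℕ) (i j : Fin m) :
    wedgeL m (e m i) ∘ₗ dotL m (e m j) + dotL m (e m j) ∘ₗ wedgeL m (e m i) =
      (if i = j then (-1 : ℝ) else 0) • LinearMap.id := by
  ext v
  have h := e_anti m i j
  have ht : (if i = j then (-1 : ℝ) else 0) = (1/2) * (if i = j then -2 else 0) := by
    split_ifs <;> norm_num
  rw [ht]
  set t : ℝ := if i = j then -2 else 0
  have hc := Algebra.commutes t v
  have hs := Algebra.smul_def t v
  rw [← h] at hc hs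
  simp only [LinearMap.add_apply, LinearMap.comp_apply, wedge_apply, dot_apply, map_smul, map_sub,
    map_add, map_mul,
    inv_e, involute_involute, LinearMap.smul_apply, LinearMap.id_apply,  ← smul_add, ← smul_sub, smul_smul]
  have h2 : (1/2 * t) • v = (1/2*(1/2) : ℝ) • (t • v + t • v) := by module
  rw [h2]
  congr 1
  conv_rhs => rw [hs]
  conv_rhs => arg 2; rw [hc]
  noncomm_ring

/-- general anticommutator lemma -/
lemma gen {ι R : Type*} [Fintype ι] [DecidableEq ι] [Ring R] [Algebra ℝ R]
    (f g α β : ι → R) (c d : ℝ)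
    (hfg : ∀ i j, f i * g j - g j * f i = (if i = j then c else 0) • (1 : R))
    (hαβ : ∀ i j, α i * β j + β j * α i = (if i = j then d else 0) • (1 : R))
    (h1 : ∀ i j, α i * g j = g j * α i)
    (h2 : ∀ i j, β i * f j = f j * β i) :
    (∑ i, f i * α i) * (∑ j, g j * β j) + (∑ j, g j * β j) * (∑ i, f i * α i) =
      c • (∑ i, α i * β i) + d • ∑ i, g i * f i := by
  have key : ∀ i j, f i * α i * (g j * β j) + g j * β j * (f i * α i) =
      (if i = j then c else 0) • (α i * β j) + (if i = j then d else 0) • (g j * f i) := by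
    intro i j
    have e1 : f i * α i * (g j * β j) = f i * g j * (α i * β j) := by
      rw [mul_assoc, ← mul_assoc (α i), h1]; noncomm_ring
    have e2 : g j * β j * (f i * α i) = g j * f i * (β j * α i) := by
      rw [mul_assoc, ← mul_assoc (β j), h2]; noncomm_ring
    have e3 : (if i = j then c else 0) • (α i * β j) =
        (f i * g j - g j * f i) * (α i * β j) := by rw [hfg]; simp
    have e4 : (if i = j then d else 0) • (g j * f i) =
        (g j * f i) * (α i * β j + β j * α i) := by rw [hαβ]; simp
    rw [e1, e2, e3, e4]; noncomm_ring
  rw [Finset.sum_mul_sum, Finset.sum_mul_sum, Finset.sum_comm (s := Finset.univ)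
    (f := fun i j => g i * β i * (f j * α j)), ← Finset.sum_add_distrib]
  simp_rw [← Finset.sum_add_distrib, key]
  simp [Finset.sum_add_distrib, ite_smul, Finset.smul_sum]

/-- x_i -/
def x (m : ℕ) (i : Fin m) : Module.End ℝ (MS m) := op m (LinearMap.mulLeft ℝ (X i)) LinearMap.id
/-- partial_i -/
def p (m : ℕ) (i : Fin m) : Module.End ℝ (MS m) := op m (pderiv i).toLinearMap LinearMap.id
/-- wedge -/
def a (m : ℕ) (i : Fin m) : Module.End ℝ (MS m) := op m LinearMap.id (wedgeL m (e m i))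
/-- dot -/
def b (m : ℕ) (i : Fin m) : Module.End ℝ (MS m) := op m LinearMap.id (dotL m (e m i))

lemma xa (m : ℕ) (i j : Fin m) : a m i * x m j = x m j * a m i := by
  simp [a, x, op_mul]
lemma xb (m : ℕ) (i j : Fin m) : b m i * x m j = x m j * b m i := by
  simp [b, x, op_mul]
lemma pa (m : ℕ) (i j : Fin m) : a m i * p m j = p m j * a m i := by
  simp [a, p, op_mul]
lemma pb (m : ℕ) (i j : Fin m) : b m i * p m j = p m j * b m i := by
  simp [b, p, op_mul]

/-- Abstract system of bosonic and fermionic operators. -/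
structure Sys (m : ℕ) (V : Type*) [AddCommGroup V] [Module ℝ V] where
  x : Fin m → Module.End ℝ V
  p : Fin m → Module.End ℝ V
  a : Fin m → Module.End ℝ V
  b : Fin m → Module.End ℝ V
  W : Module.End ℝ V
  D : Module.End ℝ V
  dp : Module.End ℝ V
  dm : Module.End ℝ V
  E : Module.End ℝ V
  F : Module.End ℝ V
  M : Module.End ℝ V
  X : Module.End ℝ V
  xx0 : ∀ i j, x i * x j = x j * x i
  pp0 : ∀ i j, p i * p j = p j * p i
  px0 : ∀ i j, p i * x j = x j * p i + (if i = j then (1:ℝ) else 0) • 1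
  AA0 : ∀ i j, a i * a j + a j * a i = 0
  BB0 : ∀ i j, b i * b j + b j * b i = 0
  AB : ∀ i j, a i * b j + b j * a i = (if i = j then (-1:ℝ) else 0) • 1
  xa : ∀ i j, a i * x j = x j * a i
  xb : ∀ i j, b i * x j = x j * b i
  pa : ∀ i j, a i * p j = p j * a i
  pb : ∀ i j, b i * p j = p j * b i
  xWedge_eq : W = ∑ i, x i * a i
  xDot_eq : D = ∑ i, x i * b i
  dplus_eq : dp = ∑ i, p i * a i
  dminus_eq : dm = ∑ i, p i * b i
  Euler_eq : E = ∑ i, x i * p i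
  ferm_eq0 : F + ∑ i, a i * b i = 0
  Mx2_eq0 : M + ∑ i, x i * x i = 0
  Xmul_eq : X = W + D

section sys
variable {m : ℕ} {V : Type*} [AddCommGroup V] [Module ℝ V]

lemma Sys.xx (r : Sys m V) (i j : Fin m) :
    r.x i * r.x j - r.x j * r.x i = (if i = j then (0:ℝ) else 0) • 1 := by
  rw [r.xx0 i j]; simp
lemma Sys.pp (r : Sys m V) (i j : Fin m) :
    r.p i * r.p j - r.p j * r.p i = (if i = j then (0:ℝ) else 0) • 1 := by
  rw [r.pp0 i j]; simp
lemma Sys.px (r : Sys m V) (i j : Fin m) :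
    r.p i * r.x j - r.x j * r.p i = (if i = j then (1:ℝ) else 0) • 1 := by
  rw [r.px0 i j]; abel
lemma Sys.AA (r : Sys m V) (i j : Fin m) :
    r.a i * r.a j + r.a j * r.a i = (if i = j then (0:ℝ) else 0) • 1 := by
  rw [r.AA0 i j]; simp
lemma Sys.BB (r : Sys m V) (i j : Fin m) :
    r.b i * r.b j + r.b j * r.b i = (if i = j then (0:ℝ) else 0) • 1 := by
  rw [r.BB0 i j]; simp
lemma Sys.BA (r : Sys m V) (i j : Fin m) :
    r.b i * r.a j + r.a j * r.b i = (if i = j then (-1:ℝ) else 0) • 1 := by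
  rw [add_comm, r.AB]; simp [eq_comm]
lemma Sys.ferm_eq (r : Sys m V) : r.F = -∑ i, r.a i * r.b i :=
  eq_neg_of_add_eq_zero_left r.ferm_eq0
lemma Sys.Mx2_eq (r : Sys m V) : r.M = -∑ i, r.x i * r.x i :=
  eq_neg_of_add_eq_zero_left r.Mx2_eq0

lemma half {R : Type*} [Ring R] [Algebra ℝ R] {u : R} (h : u + u = 0) : u = 0 := by
  have : u = (1/2 : ℝ) • (u + u) := by module
  rw [this, h, smul_zero]

lemma WW (r : Sys m V) : r.W * r.W = 0 := by
  apply half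
  have := gen (r.x) (r.x) (r.a) (r.a) 0 0 (r.xx) (r.AA) (r.xa) (r.xa)
  simpa [← r.xWedge_eq] using this
lemma DD (r : Sys m V) : r.D * r.D = 0 := by
  apply half
  have := gen (r.x) (r.x) (r.b) (r.b) 0 0 (r.xx) (r.BB) (r.xb) (r.xb)
  simpa [← r.xDot_eq] using this
lemma WD (r : Sys m V) : r.W * r.D + r.D * r.W = r.M := by
  have := gen (r.x) (r.x) (r.a) (r.b) 0 (-1) (r.xx) (r.AB) (r.xa) (r.xb)
  simpa [← r.xDot_eq, ← r.xWedge_eq, ← r.Mx2_eq] using this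
lemma dpp (r : Sys m V) : r.dp * r.dp = 0 := by
  apply half
  have := gen (r.p) (r.p) (r.a) (r.a) 0 0 (r.pp) (r.AA) (r.pa) (r.pa)
  simpa [← r.dplus_eq] using this
lemma dmm (r : Sys m V) : r.dm * r.dm = 0 := by
  apply half
  have := gen (r.p) (r.p) (r.b) (r.b) 0 0 (r.pp) (r.BB) (r.pb) (r.pb)
  simpa [← r.dminus_eq] using this
lemma dpW (r : Sys m V) : r.dp * r.W + r.W * r.dp = 0 := by
  have := gen (r.p) (r.x) (r.a) (r.a) 1 0 (r.px) (r.AA) (r.xa) (r.pa)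
  have h : ∀ i, r.a i * r.a i = 0 := fun i => half (by simpa using r.AA i i)
  simpa [← r.dplus_eq, ← r.xWedge_eq, h] using this
lemma dmD (r : Sys m V) : r.dm * r.D + r.D * r.dm = 0 := by
  have := gen (r.p) (r.x) (r.b) (r.b) 1 0 (r.px) (r.BB) (r.xb) (r.pb)
  have h : ∀ i, r.b i * r.b i = 0 := fun i => half (by simpa using r.BB i i)
  simpa [← r.dminus_eq, ← r.xDot_eq, h] using this
lemma dpD (r : Sys m V) : r.dp * r.D + r.D * r.dp = -(r.E + r.F) := by
  have := gen (r.p) (r.x) (r.a) (r.b) 1 (-1) (r.px) (r.AB) (r.xa) (r.pb)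
  rw [← r.dplus_eq, ← r.xDot_eq, ← r.Euler_eq] at this
  rw [this, r.ferm_eq]
  module
lemma dmW (r : Sys m V) : r.dm * r.W + r.W * r.dm =
    -(r.E - r.F + (m : ℝ) • 1) := by
  have := gen (r.p) (r.x) (r.b) (r.a) 1 (-1) (r.px) (r.BA) (r.xb) (r.pa)
  rw [← r.dminus_eq, ← r.xWedge_eq, ← r.Euler_eq] at this
  have h : ∑ i, r.b i * r.a i + ∑ i, r.a i * r.b i = -((m : ℝ) • 1) := by
    rw [← Finset.sum_add_distrib]
    have h2 : ∀ i, r.b i * r.a i + r.a i * r.b i = (-1 : ℝ) • 1 := by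
      intro i; simpa using r.BA i i
    simp only [h2, Finset.sum_const, Finset.card_univ, Fintype.card_fin]
    module
  rw [this, eq_sub_of_add_eq h, r.ferm_eq]
  module

lemma Ecomm (r : Sys m V) (c : Fin m → Module.End ℝ V)
    (h1 : ∀ i j, c i * r.x j = r.x j * c i) (h2 : ∀ i j, c i * r.p j = r.p j * c i) :
    r.E * (∑ i, r.x i * c i) = (∑ i, r.x i * c i) * r.E + ∑ i, r.x i * c i := by
  rw [r.Euler_eq, Finset.sum_mul_sum, Finset.sum_mul_sum, Finset.sum_comm,
    ← Finset.sum_add_distrib]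
  refine Finset.sum_congr rfl fun i _ => ?_
  have key : ∀ j, r.x j * r.p j * (r.x i * c i) = r.x i * c i * (r.x j * r.p j) +
      (if j = i then (1:ℝ) else 0) • (r.x j * c i) := by
    intro j
    have e1 : r.x i * c i * (r.x j * r.p j) = r.x i * r.x j * r.p j * c i := by
      rw [mul_assoc, ← mul_assoc (c i), h1, mul_assoc (r.x j), h2]; noncomm_ring
    have e2 : r.x i * r.x j = r.x j * r.x i := by
      have := r.xx i j
      simpa [sub_eq_zero] using this
    have e3 : (if j = i then (1:ℝ) else 0) • (r.x j * c i) =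
       r.x j * (r.p j * r.x i - r.x i * r.p j) * c i := by rw [r.px]; simp
    rw [e1, e2, e3]; noncomm_ring
  simp [key, Finset.sum_add_distrib]

lemma ED (r : Sys m V) : r.E * r.D = r.D * r.E + r.D := by
  rw [r.xDot_eq]; exact Ecomm r (r.b) (r.xb) (r.pb)
lemma EW (r : Sys m V) : r.E * r.W = r.W * r.E + r.W := by
  rw [r.xWedge_eq]; exact Ecomm r (r.a) (r.xa) (r.pa)

section abstract_algebra
variable {R : Type*} [Ring R] [Algebra ℝ R]

lemma MW {W D M : R} (hW : W * W = 0) (hM : W * D + D * W = M) : W * M = M * W := by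
  have h1 : W * M = W * W * D + W * D * W := by rw [← hM]; noncomm_ring
  have h2 : M * W = W * D * W + D * (W * W) := by rw [← hM]; noncomm_ring
  rw [h1, h2, hW]; simp

lemma powcomm {d M W : R} (h : d * M = M * d - (2 : ℝ) • W) (hc : W * M = M * W) (j : ℕ) :
    d * M ^ (j + 1) = M ^ (j + 1) * d - (2 * (j + 1) : ℝ) • (M ^ j * W) := by
  induction j with
  | zero => simp [h]
  | succ n ih =>
    have hp : W * M ^ (n + 1) = M ^ (n + 1) * W := (Commute.pow_right (show Commute W M from hc) _)
    rw [pow_succ' M (n + 1), ← mul_assoc, h, sub_mul, mul_assoc M d, ih, smul_mul_assoc, hp]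
    rw [mul_sub, ← mul_assoc M, mul_smul_comm, ← mul_assoc M (M ^ n), ← pow_succ' M n, ← pow_succ' M (n + 1)]
    push_cast
    module

end abstract_algebra

lemma MWc (r : Sys m V) : r.W * r.M = r.M * r.W := MW (WW r) (WD r)
lemma MDc (r : Sys m V) : r.D * r.M = r.M * r.D :=
  MW (DD r) (by rw [add_comm]; exact WD r)

lemma dpA (r : Sys m V) : r.dp * (r.E + r.F) = (r.E + r.F) * r.dp := by
  have h := dpD r
  have hA : r.E + r.F = -(r.D * r.dp + r.dp * r.D) := by
    rw [add_comm (r.D * _), h, neg_neg]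
  rw [hA, mul_neg, neg_mul, add_comm (r.D * _), MW (dpp r) rfl]

lemma DA (r : Sys m V) : r.D * (r.E + r.F) = (r.E + r.F) * r.D := by
  have h := dpD r
  have hA : r.E + r.F = -(r.D * r.dp + r.dp * r.D) := by
    rw [add_comm (r.D * _), h, neg_neg]
  rw [hA, mul_neg, neg_mul, MW (DD r) rfl]

lemma dmB (r : Sys m V) : r.dm * (r.E - r.F + (m : ℝ) • 1) =
    (r.E - r.F + (m : ℝ) • 1) * r.dm := by
  have hA : (r.E - r.F + (m : ℝ) • 1) =
      -(r.dm * r.W + r.W * r.dm) := by rw [dmW, neg_neg]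
  rw [hA, mul_neg, neg_mul, MW (dmm r) rfl]

lemma WB (r : Sys m V) : r.W * (r.E - r.F + (m : ℝ) • 1) =
    (r.E - r.F + (m : ℝ) • 1) * r.W := by
  have hA : (r.E - r.F + (m : ℝ) • 1) =
      -(r.W * r.dm + r.dm * r.W) := by rw [add_comm (r.W * _), dmW, neg_neg]
  rw [hA, mul_neg, neg_mul, MW (WW r) rfl]

lemma FW (r : Sys m V) : r.F * r.W = r.W * r.F + r.W := by
  have h := WB r
  have h2 := EW r
  simp only [mul_add, mul_sub, add_mul, sub_mul, mul_smul_comm, smul_mul_assoc, mul_one,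
    one_mul, add_left_inj, h2] at h
  rw [sub_eq_sub_iff_add_eq_add] at h
  rw [add_assoc, add_left_cancel_iff] at h
  rw [h, add_comm]

lemma FD (r : Sys m V) : r.F * r.D = r.D * r.F - r.D := by
  have h := DA r
  have h2 := ED r
  simp only [mul_add, add_mul, h2] at h
  rw [add_assoc, add_left_cancel_iff] at h
  rw [h]; abel

lemma dpM (r : Sys m V) : r.dp * r.M = r.M * r.dp - (2 : ℝ) • r.W := by
  have h1 : r.dp * r.W = - (r.W * r.dp) := eq_neg_of_add_eq_zero_left (dpW r)
  have h2 : r.dp * r.D = -(r.E + r.F) - r.D * r.dp :=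
    eq_sub_of_add_eq (dpD r)
  rw [← WD, mul_add, ← mul_assoc, ← mul_assoc, h1, h2, neg_mul, mul_assoc, h2, sub_mul,
    mul_assoc (r.D), h1, neg_mul, add_mul, EW, FW, two_smul]
  noncomm_ring

lemma dmM (r : Sys m V) : r.dm * r.M = r.M * r.dm - (2 : ℝ) • r.D := by
  have h1 : r.dm * r.D = - (r.D * r.dm) := eq_neg_of_add_eq_zero_left (dmD r)
  have h2 : r.dm * r.W = -(r.E - r.F + (m : ℝ) • 1) - r.W * r.dm :=
    eq_sub_of_add_eq (dmW r)
  rw [← WD, mul_add, ← mul_assoc, ← mul_assoc, h1, h2, neg_mul, mul_assoc (r.D), h2, sub_mul,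
    mul_assoc (r.W), h1, neg_mul, add_mul, sub_mul, ED, FD, two_smul]
  simp only [mul_sub, mul_add, mul_neg, add_mul, smul_mul_assoc, mul_smul_comm, mul_one, one_mul,
    mul_assoc]
  abel

lemma Wpow (r : Sys m V) (j : ℕ) : r.W * r.M ^ j = r.M ^ j * r.W :=
  Commute.pow_right (show Commute (r.W) (r.M) from MWc r) j
lemma Dpow (r : Sys m V) (j : ℕ) : r.D * r.M ^ j = r.M ^ j * r.D :=
  Commute.pow_right (show Commute (r.D) (r.M) from MDc r) j

lemma L1 (r : Sys m V) (j : ℕ) : r.dp * (r.M ^ j * r.W) = -(r.M ^ j * r.W * r.dp) := by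
  have h1 : r.dp * r.W = - (r.W * r.dp) := eq_neg_of_add_eq_zero_left (dpW r)
  cases j with
  | zero => simp [h1]
  | succ n =>
    rw [← mul_assoc, powcomm (dpM r) (MWc r), sub_mul, mul_assoc, h1, smul_mul_assoc,
      mul_assoc (r.M ^ n), WW]
    simp [mul_assoc]

lemma DWD (r : Sys m V) : r.D * (r.W * r.D) = r.M * r.D := by
  rw [← WD, add_mul, mul_assoc, DD, mul_zero, zero_add, mul_assoc]

lemma L2 (r : Sys m V) (j : ℕ) : r.dm * (r.M ^ j * (r.W * r.D)) =
    r.M ^ j * (r.dm * (r.W * r.D)) - (2 * j : ℝ) • (r.M ^ j * r.D) := by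
  cases j with
  | zero => simp
  | succ n =>
    rw [← mul_assoc, powcomm (dmM r) (MDc r), sub_mul, smul_mul_assoc, mul_assoc (r.M ^ n), DWD,
      ← mul_assoc (r.M ^ n), ← pow_succ, mul_assoc]
    push_cast
    rfl

lemma L3 (r : Sys m V) : r.dm * (r.W * r.D) = r.W * r.D * r.dm -
    r.D * (r.E - r.F + ((m : ℝ) + 2) • 1) := by
  have h1 : r.dm * r.D = - (r.D * r.dm) := eq_neg_of_add_eq_zero_left (dmD r)
  have h2 : r.dm * r.W = -(r.E - r.F + (m : ℝ) • 1) - r.W * r.dm :=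
    eq_sub_of_add_eq (dmW r)
  rw [← mul_assoc, h2, sub_mul, neg_mul, add_mul, sub_mul, ED, FD, mul_assoc (r.W), h1]
  simp only [mul_sub, mul_add, mul_neg, smul_mul_assoc, mul_smul_comm, mul_one, one_mul,
    mul_assoc]
  module

lemma Y_eq (r : Sys m V) (j : ℕ) (c : ℝ) : r.M ^ j * r.X *
        (r.D * (r.E + r.F + c • (1 : Module.End ℝ V)) +
         r.W * (r.E + r.F)) =
    r.M ^ (j + 1) * (r.E + r.F) + c • (r.M ^ j * (r.W * r.D)) := by
  have h : r.X * (r.D * (r.E + r.F + c • (1 : Module.End ℝ V)) +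
         r.W * (r.E + r.F)) =
      r.M * (r.E + r.F) + c • (r.W * r.D) := by
    rw [r.Xmul_eq, mul_add, ← mul_assoc, ← mul_assoc, add_mul (r.W), add_mul (r.W), DD, WW,
      add_zero, zero_add, mul_add _ _ (c • 1), mul_smul_comm, mul_one, add_right_comm, ← add_mul,
      WD]
  rw [mul_assoc, h, mul_add, ← mul_assoc, ← pow_succ, mul_smul_comm]

theorem final (r : Sys m V) (j k l : ℕ) (hk : k = l + 2 * j + 2) (P : V)
    (hE : r.E P = (l : ℝ) • P) (hp : r.dp P = 0) (hm : r.dm P = 0) :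
    r.dp ((r.M ^ j * r.X *
        (r.D * (r.E + r.F + ((2 * j + 2 : ℝ)) • (1 : Module.End ℝ V)) +
         r.W * (r.E + r.F))) P) = 0 ∧
    r.dm ((r.M ^ j * r.X *
        (r.D * (r.E + r.F + ((2 * j + 2 : ℝ)) • (1 : Module.End ℝ V)) +
         r.W * (r.E + r.F))) P) =
      (-(((2 * j + 2 : ℕ) : ℝ) * ((m : ℝ) + 2 * (k : ℝ) - 2 * (j : ℝ) - 2))) •
        ((r.M ^ j * r.D) P) := by
  rw [Y_eq]
  have hpA : r.dp ((r.E + r.F) P) = 0 := by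
    rw [← Module.End.mul_apply, dpA, Module.End.mul_apply, hp, map_zero]
  have hmA : r.dm ((r.E + r.F) P) = 0 := by
    have h : r.E + r.F =
        (2 : ℝ) • r.E + (m : ℝ) • 1 - (r.E - r.F + (m : ℝ) • 1) := by module
    rw [h, LinearMap.sub_apply, map_sub, ← Module.End.mul_apply _ (_ + _ : Module.End ℝ (V)),
      ← Module.End.mul_apply _ (_ + _ : Module.End ℝ (V)), dmB]
    simp [hE, hm]
  constructor
  · rw [← Module.End.mul_apply, mul_add, ← mul_assoc, powcomm (dpM r) (MWc r),
      mul_smul_comm, ← mul_assoc (r.M ^ j), ← mul_assoc (r.dp), L1, neg_mul,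
      mul_assoc _ (r.dp), eq_sub_of_add_eq (dpD r), sub_mul, mul_sub]
    simp only [LinearMap.add_apply, LinearMap.sub_apply, LinearMap.neg_apply, LinearMap.smul_apply,
      Module.End.mul_apply, hp, map_zero, map_neg]
    simp only [← LinearMap.add_apply, hpA, map_zero]
    module
  · rw [← Module.End.mul_apply, mul_add, ← mul_assoc, powcomm (dmM r) (MDc r),
      mul_smul_comm, L2, L3]
    simp only [LinearMap.add_apply (_ : Module.End ℝ (V)) (_ : Module.End ℝ (V)),
      LinearMap.sub_apply, LinearMap.smul_apply, sub_mul,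
      Module.End.mul_apply, hm, map_zero, mul_sub]
    have hm' : r.dm (r.E P + r.F P) = 0 := hmA
    rw [hm']
    simp only [hE, map_zero, map_add, map_sub, map_smul, Module.End.one_apply]
    subst hk
    push_cast
    module

end sys

lemma xx (m : ℕ) (i j : Fin m) : x m i * x m j = x m j * x m i := by
  have : (LinearMap.mulLeft ℝ (X i : Pm m)) ∘ₗ LinearMap.mulLeft ℝ (X j) =
     (LinearMap.mulLeft ℝ (X j : Pm m)) ∘ₗ LinearMap.mulLeft ℝ (X i) := by
    apply LinearMap.ext; intro v; simp [mul_left_comm]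
  simp only [x, op_mul, this]

lemma pp (m : ℕ) (i j : Fin m) : p m i * p m j = p m j * p m i := by
  have : (pderiv i).toLinearMap ∘ₗ (pderiv j).toLinearMap =
     (pderiv j).toLinearMap ∘ₗ ((pderiv i).toLinearMap : Pm m →ₗ[ℝ] Pm m) := by
    apply LinearMap.ext; intro v
    have h : ⁅(pderiv i : Derivation ℝ (Pm m) (Pm m)),
        (pderiv j : Derivation ℝ (Pm m) (Pm m))⁆ = 0 := by
      apply MvPolynomial.derivation_ext
      intro k
      simp [Derivation.commutator_apply, pderiv_X, Pi.single_apply, apply_ite]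
    have := congrArg (fun D : Derivation ℝ (Pm m) (Pm m) => D v) h
    simpa [Derivation.commutator_apply, sub_eq_zero] using this
  simp only [p, op_mul, this]

lemma op_id (m : ℕ) : op m LinearMap.id LinearMap.id = 1 := TensorProduct.map_id

lemma px (m : ℕ) (i j : Fin m) :
    p m i * x m j = x m j * p m i + (if i = j then (1:ℝ) else 0) • 1 := by
  have : (pderiv i).toLinearMap ∘ₗ (LinearMap.mulLeft ℝ (X j : Pm m)) =
     (LinearMap.mulLeft ℝ (X j : Pm m)) ∘ₗ (pderiv i).toLinearMap +
      (if i = j then (1:ℝ) else 0) • LinearMap.id := by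
    apply LinearMap.ext; intro v
    simp [Derivation.leibniz, pderiv_X, Pi.single_apply, eq_comm]
    split_ifs <;> simp
  simp only [p, x, op_mul, this, LinearMap.id_comp, ← op_id]
  refine (TensorProduct.map_add_left _ _ _).trans ?_
  exact congrArg _ (TensorProduct.map_smul_left _ _ _)

lemma op_add (m : ℕ) (g h : Cl m →ₗ[ℝ] Cl m) :
    op m LinearMap.id g + op m LinearMap.id h = op m LinearMap.id (g + h) :=
  (TensorProduct.map_add_right _ _ _).symm

lemma AA (m : ℕ) (i j : Fin m) : a m i * a m j + a m j * a m i = 0 := by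
  simp only [a, op_mul, LinearMap.id_comp, op_add, aa]
  exact TensorProduct.map_zero_right _
lemma BB (m : ℕ) (i j : Fin m) : b m i * b m j + b m j * b m i = 0 := by
  simp only [b, op_mul, LinearMap.id_comp, op_add, bb]
  exact TensorProduct.map_zero_right _
lemma AB (m : ℕ) (i j : Fin m) :
    a m i * b m j + b m j * a m i = (if i = j then (-1:ℝ) else 0) • 1 := by
  simp only [a, b, op_mul, LinearMap.id_comp, op_add, ab, ← op_id]
  exact TensorProduct.map_smul_right _ _ _

lemma xWedge_eq (m : ℕ) : xWedge m = ∑ i, x m i * a m i := by simp [xWedge, x, a, op_mul]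
lemma xDot_eq (m : ℕ) : xDot m = ∑ i, x m i * b m i := by simp [xDot, x, b, op_mul]
lemma dplus_eq (m : ℕ) : dplus m = ∑ i, p m i * a m i := by simp [dplus, p, a, op_mul]
lemma dminus_eq (m : ℕ) : dminus m = ∑ i, p m i * b m i := by simp [dminus, p, b, op_mul]
lemma Euler_eq (m : ℕ) : Euler m = ∑ i, x m i * p m i := by simp [Euler, p, x, op_mul]
lemma ferm_eq (m : ℕ) : fermPlus m + ∑ i, a m i * b m i = 0 := by
  simp only [fermPlus, a, b, op_mul, LinearMap.id_comp]
  exact neg_add_cancel (∑ i, op m LinearMap.id (wedgeL m (e m i) ∘ₗ dotL m (e m i)))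
lemma Mx2_eq (m : ℕ) : Mx2 m + ∑ i, x m i * x m i = 0 := by
  simp only [x, op_mul, Mx2, LinearMap.id_comp]
  have h : ∑ i : Fin m, op m (LinearMap.mulLeft ℝ (X i) ∘ₗ LinearMap.mulLeft ℝ (X i)) LinearMap.id
      = op m (∑ i : Fin m, LinearMap.mulLeft ℝ (X i) ∘ₗ LinearMap.mulLeft ℝ (X i))
        LinearMap.id := by
    apply TensorProduct.ext'
    intro u v
    simp only [op, LinearMap.sum_apply, TensorProduct.map_tmul, TensorProduct.sum_tmul]
  rw [h]
  refine (TensorProduct.map_add_left _ _ _).symm.trans ?_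
  have h2 : LinearMap.mulLeft ℝ (-(∑ j : Fin m, (X j : Pm m) ^ 2)) +
      ∑ j, LinearMap.mulLeft ℝ (X j : Pm m) ∘ₗ LinearMap.mulLeft ℝ (X j) = 0 := by
    apply LinearMap.ext; intro v
    simp [Finset.sum_mul, pow_two, mul_assoc]
  rw [h2]
  exact TensorProduct.map_zero_left _

lemma Xmul_eq (m : ℕ) : Xmul m = xWedge m + xDot m := by
  simp only [Xmul, xWedge, xDot, ← Finset.sum_add_distrib]
  refine Finset.sum_congr rfl fun i _ => ?_
  refine Eq.trans ?_ (TensorProduct.map_add_right _ _ _)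
  unfold op
  congr 1
  apply LinearMap.ext; intro v
  simp only [LinearMap.add_apply, wedge_apply, dot_apply, LinearMap.mulLeft_apply]
  module

/-- The concrete system. -/
def conc (m : ℕ) : Sys m (MS m) where
  x := x m
  p := p m
  a := a m
  b := b m
  W := xWedge m
  D := xDot m
  dp := dplus m
  dm := dminus m
  E := Euler m
  F := fermPlus m
  M := Mx2 m
  X := Xmul m
  xx0 := xx m
  pp0 := pp m
  px0 := px m
  AA0 := AA m
  BB0 := BB m
  AB := AB m
  xa := xa m
  xb := xb m
  pa := pa m
  pb := pb m
  xWedge_eq := xWedge_eq m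
  xDot_eq := xDot_eq m
  dplus_eq := dplus_eq m
  dminus_eq := dminus_eq m
  Euler_eq := Euler_eq m
  ferm_eq0 := ferm_eq m
  Mx2_eq0 := Mx2_eq m
  Xmul_eq := Xmul_eq m

lemma EP (m l s : ℕ) (P : MS m) (hP : P ∈ Pks m l s) : Euler m P = (l : ℝ) • P := by
  obtain ⟨Q, rfl⟩ := hP
  induction Q using TensorProduct.induction_on with
  | zero => simp
  | add u v hu hv => simp [hu, hv]
  | tmul u v =>
    have hu : (u : Pm m).IsHomogeneous l := (mem_homogeneousSubmodule l _).1 u.2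
    have h := hu.sum_X_mul_pderiv
    simp only [Euler, op, LinearMap.sum_apply, TensorProduct.map_tmul, LinearMap.comp_apply,
      LinearMap.mulLeft_apply, LinearMap.id_apply, Submodule.subtype_apply]
    rw [← TensorProduct.sum_tmul]
    have h' : ∑ i, X i * (pderiv i).toLinearMap (u : Pm m) = (l : ℝ) • (u : Pm m) := by
      rw [Nat.cast_smul_eq_nsmul]; exact h
    rw [h', TensorProduct.smul_tmul']

end S18

end

/-- on H_{k-2j-2}^s (written here with l = k-2j-2, i.e. k = l+2j+2), the
operator Ẏ_{2j+2} = x^{2j+1}((x•)(A+2j+2) + (x∧)A) satisfies ∂⁺Ẏ_{2j+2} = 0 and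
∂⁻Ẏ_{2j+2} = -(2j+2)(m+2k-2j-2) x^{2j}(x•). -/
theorem stmt18 (m j k l s : ℕ) (hk : k = l + 2 * j + 2) (P : MS m) (hP : P ∈ Hks m l s) :
    (dplus m) ((Mx2 m ^ j * Xmul m *
        (xDot m * (Euler m + fermPlus m + ((2 * j + 2 : ℝ)) • (1 : Module.End ℝ (MS m))) +
         xWedge m * (Euler m + fermPlus m))) P) = 0 ∧
    (dminus m) ((Mx2 m ^ j * Xmul m *
        (xDot m * (Euler m + fermPlus m + ((2 * j + 2 : ℝ)) • (1 : Module.End ℝ (MS m))) +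
         xWedge m * (Euler m + fermPlus m))) P) =
      (-(((2 * j + 2 : ℕ) : ℝ) * ((m : ℝ) + 2 * (k : ℝ) - 2 * (j : ℝ) - 2))) •
        ((Mx2 m ^ j * xDot m) P) := by
  obtain ⟨⟨hPk, hp⟩, hm⟩ := hP
  exact S18.final (S18.conc m) j k l hk P (S18.EP m l s P hPk) hp hm
end
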